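/- For every z ∈ ℝ^d, every (t_0,x_0) ∈ [0,T)×Ω, every y_0 ∈ ℝ, and every s ≥ 0, one has μ^z_+(t_0,x_0,y_0+s) ≤ μ^z_+(t_0,x_0,y_0) − s (as an inequality in [−∞,∞)). -/

import Mathlib

open MeasureTheory Set Filter Topology
open scoped InnerProductSpace

noncomputable section

namespace PHJ

/-- The Euclidean state space `ℝ^d`. -/
abbrev E (d : ℕ) := EuclideanSpace ℝ (Fin d)

/-- A path; only its values on `[0, T]` are relevant. -/
abbrev Path (d : ℕ) := ℝ → E d

/-- The set `Ω = D([0,T], ℝ^d)` of paths that are right-continuous on `[0,T)` and have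
left limits on `(0,T]`. -/
def Cadlag (T : ℝ) (d : ℕ) : Set (Path d) :=
  {x | (∀ t ∈ Ico (0 : ℝ) T, ContinuousWithinAt x (Ici t) t) ∧
       (∀ t ∈ Ioc (0 : ℝ) T, ∃ l : E d, Tendsto x (nhdsWithin t (Iio t)) (nhds l))}

/-- The running supremum `sup_{0 ≤ s ≤ t} |x(s)|`. -/
def runSup (d : ℕ) (x : Path d) (t : ℝ) : ℝ :=
  sSup ((fun s => ‖x s‖) '' Icc 0 t)

/-- The supremum distance `sup_{0 ≤ s ≤ T} |x(s) − y(s)|`. -/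
def supDist (T : ℝ) (d : ℕ) (x y : Path d) : ℝ :=
  sSup ((fun s => ‖x s - y s‖) '' Icc 0 T)

/-- The stopped supremum distance `sup_{0 ≤ r ≤ T} |x(r ∧ t) − y(r ∧ s)|`. -/
def stopDist (T : ℝ) (d : ℕ) (t : ℝ) (x : Path d) (s : ℝ) (y : Path d) : ℝ :=
  sSup ((fun r => ‖x (min r t) - y (min r s)‖) '' Icc 0 T)

/-- The pseudometric `d_∞` on `[0,T] × Ω`. -/
def dInf (T : ℝ) (d : ℕ) (p q : ℝ × Path d) : ℝ :=
  |p.1 - q.1| + stopDist T d p.1 p.2 q.1 q.2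

/-- `g` is an integrable a.e.-derivative of `x` on `[s₀, T]` (so that `x` is absolutely
continuous there) satisfying the growth bound `|x′(t)| ≤ L (1 + sup_{s ≤ t} |x(s)|)` a.e. -/
def XDeriv (T : ℝ) (d : ℕ) (L s₀ : ℝ) (x g : Path d) : Prop :=
  IntegrableOn g (Icc s₀ T) volume ∧
  (∀ t ∈ Icc s₀ T, x t = x s₀ + ∫ s in s₀..t, g s) ∧
  (∀ᵐ t ∂(volume.restrict (Ioo s₀ T)), ‖g t‖ ≤ L * (1 + runSup d x t))

/-- The set `X^L(s₀, x₀)` of "Lipschitz-like" paths. -/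
def XSet (T : ℝ) (d : ℕ) (L s₀ : ℝ) (x₀ : Path d) : Set (Path d) :=
  {x | x ∈ Cadlag T d ∧ (∀ t ∈ Icc 0 s₀, x t = x₀ t) ∧ ∃ g, XDeriv T d L s₀ x g}

/-- Type of Hamiltonians `H(t, x, y, z)`. -/
abbrev Ham (d : ℕ) := ℝ → Path d → ℝ → E d → ℝ

/-- The set `Y^L(s₀, x₀, y₀, z)` of characteristic pairs `(x, y)`. -/
def YSet (T : ℝ) (d : ℕ) (H : Ham d) (L s₀ : ℝ) (x₀ : Path d) (y₀ : ℝ) (z : E d) :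
    Set (Path d × (ℝ → ℝ)) :=
  {p | p.1 ∈ Cadlag T d ∧ (∀ t ∈ Icc 0 s₀, p.1 t = x₀ t) ∧
       ContinuousOn p.2 (Icc s₀ T) ∧
       ∃ g, XDeriv T d L s₀ p.1 g ∧
         IntegrableOn (fun s => ⟪g s, z⟫_ℝ - H s p.1 (p.2 s) z) (Icc s₀ T) volume ∧
         ∀ t ∈ Icc s₀ T, p.2 t = y₀ + ∫ s in s₀..t, (⟪g s, z⟫_ℝ - H s p.1 (p.2 s) z)}

/-- Assumption (i): for a.e. `t`, `(x, y, z) ↦ H(t, x, y, z)` is continuous. -/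
def HamCont (T : ℝ) (d : ℕ) (H : Ham d) : Prop :=
  ∀ᵐ t ∂(volume.restrict (Ioo (0 : ℝ) T)),
    ∀ x ∈ Cadlag T d, ∀ (y : ℝ) (z : E d), ∀ ε > (0 : ℝ), ∃ δ > (0 : ℝ),
      ∀ x' ∈ Cadlag T d, ∀ (y' : ℝ) (z' : E d),
        supDist T d x x' < δ → |y - y'| < δ → ‖z - z'‖ < δ →
        |H t x y z - H t x' y' z'| < ε

/-- Assumption (ii): `t ↦ H(t, x, y, z)` is Borel measurable. -/
def HamMeas (d : ℕ) (H : Ham d) : Prop :=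
  ∀ (x : Path d) (y : ℝ) (z : E d), Measurable fun t => H t x y z

/-- Assumption (iii): Lipschitz continuity in `z` with constant `L_H (1 + sup_{s≤t} |x(s)|)`. -/
def HamLipZ (T : ℝ) (d : ℕ) (H : Ham d) (LH : ℝ) : Prop :=
  0 ≤ LH ∧ ∀ᵐ t ∂(volume.restrict (Ioo (0 : ℝ) T)),
    ∀ x ∈ Cadlag T d, ∀ (y : ℝ) (z z' : E d),
      |H t x y z - H t x y z'| ≤ LH * (1 + runSup d x t) * ‖z - z'‖

/-- Assumption (iv): local Lipschitz continuity in `x` along `X^L`-paths,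
with constant `M L`. -/
def HamLipX (T : ℝ) (d : ℕ) (H : Ham d) (M : ℝ → ℝ) : Prop :=
  ∀ L ≥ (0 : ℝ), 0 ≤ M L ∧
    ∀ t₀ ∈ Ico (0 : ℝ) T, ∀ x₀ ∈ Cadlag T d,
      ∀ x ∈ XSet T d L t₀ x₀, ∀ x' ∈ XSet T d L t₀ x₀, ∀ (y : ℝ) (z : E d),
        ∀ᵐ t ∂(volume.restrict (Ioo t₀ T)),
          |H t x y z - H t x' y z| ≤
            M L * (1 + |y| + ‖z‖) * sSup ((fun s => ‖x s - x' s‖) '' Icc 0 t)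

/-- Assumption (v): `y ↦ H(t, x, y, z)` is non-increasing. -/
def HamMono (T : ℝ) (d : ℕ) (H : Ham d) : Prop :=
  ∀ᵐ t ∂(volume.restrict (Ioo (0 : ℝ) T)),
    ∀ x ∈ Cadlag T d, ∀ (z : E d) (y y' : ℝ), y ≤ y' → H t x y' z ≤ H t x y z

/-- Assumption (vi): growth bound `|H(t, x, y, 0)| ≤ C_H (1 + sup_{s≤t}|x(s)| + |y|)`. -/
def HamBound (T : ℝ) (d : ℕ) (H : Ham d) (CH : ℝ) : Prop :=
  0 ≤ CH ∧ ∀ᵐ t ∂(volume.restrict (Ioo (0 : ℝ) T)),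
    ∀ x ∈ Cadlag T d, ∀ y : ℝ, |H t x y 0| ≤ CH * (1 + runSup d x t + |y|)

/-- Lower semicontinuity on `[0,T] × Ω` with respect to `d_∞`. -/
def LscOn (T : ℝ) (d : ℕ) (u : ℝ → Path d → ℝ) : Prop :=
  ∀ t₀ ∈ Icc (0 : ℝ) T, ∀ x₀ ∈ Cadlag T d, ∀ c : ℝ, c < u t₀ x₀ →
    ∃ δ > (0 : ℝ), ∀ t ∈ Icc (0 : ℝ) T, ∀ x ∈ Cadlag T d,
      dInf T d (t₀, x₀) (t, x) < δ → c < u t x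

/-- Upper semicontinuity on `[0,T] × Ω` with respect to `d_∞`. -/
def UscOn (T : ℝ) (d : ℕ) (u : ℝ → Path d → ℝ) : Prop :=
  ∀ t₀ ∈ Icc (0 : ℝ) T, ∀ x₀ ∈ Cadlag T d, ∀ c : ℝ, u t₀ x₀ < c →
    ∃ δ > (0 : ℝ), ∀ t ∈ Icc (0 : ℝ) T, ∀ x ∈ Cadlag T d,
      dInf T d (t₀, x₀) (t, x) < δ → u t x < c

/-- Continuity of the terminal condition `h` with respect to the sup norm. -/
def TermCont (T : ℝ) (d : ℕ) (h : Path d → ℝ) : Prop :=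
  ∀ x ∈ Cadlag T d, ∀ ε > (0 : ℝ), ∃ δ > (0 : ℝ), ∀ x' ∈ Cadlag T d,
    supDist T d x x' < δ → |h x' - h x| < ε

/-- `u` is a minimax `L`-supersolution of the terminal-value problem (TVP). -/
def MinimaxSuper (T : ℝ) (d : ℕ) (H : Ham d) (h : Path d → ℝ) (L : ℝ)
    (u : ℝ → Path d → ℝ) : Prop :=
  LscOn T d u ∧ (∀ x ∈ Cadlag T d, h x ≤ u T x) ∧
  ∀ s₀ ∈ Ico (0 : ℝ) T, ∀ x₀ ∈ Cadlag T d, ∀ (z : E d) (y₀ : ℝ), u s₀ x₀ ≤ y₀ →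
    ∃ p ∈ YSet T d H L s₀ x₀ y₀ z, ∀ t ∈ Icc s₀ T, u t p.1 ≤ p.2 t

/-- `u` is a minimax `L`-subsolution of the terminal-value problem (TVP). -/
def MinimaxSub (T : ℝ) (d : ℕ) (H : Ham d) (h : Path d → ℝ) (L : ℝ)
    (u : ℝ → Path d → ℝ) : Prop :=
  UscOn T d u ∧ (∀ x ∈ Cadlag T d, u T x ≤ h x) ∧
  ∀ s₀ ∈ Ico (0 : ℝ) T, ∀ x₀ ∈ Cadlag T d, ∀ (z : E d) (y₀ : ℝ), y₀ ≤ u s₀ x₀ →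
    ∃ p ∈ YSet T d H L s₀ x₀ y₀ z, ∀ t ∈ Icc s₀ T, p.2 t ≤ u t p.1

/-- `u` is a minimax `L`-solution of the terminal-value problem (TVP). -/
def MinimaxSol (T : ℝ) (d : ℕ) (H : Ham d) (h : Path d → ℝ) (L : ℝ)
    (u : ℝ → Path d → ℝ) : Prop :=
  MinimaxSuper T d H h L u ∧ MinimaxSub T d H h L u

/-- Embedding of a path into the space of functions on `[0,T]` with the topology of
uniform convergence (i.e. the sup-norm topology). -/
def toUnif (T : ℝ) (d : ℕ) (x : Path d) : UniformFun (Icc (0 : ℝ) T) (E d) :=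
  UniformFun.ofFun fun s => x s.1

/-- Embedding of a real-valued function into the space of functions on `[s₀,T]` with the
topology of uniform convergence. -/
def toUnifR (T s₀ : ℝ) (y : ℝ → ℝ) : UniformFun (Icc s₀ T) ℝ :=
  UniformFun.ofFun fun s => y s.1


/-- Continuity on `[0,T] × Ω` with respect to `d_∞`. -/
def Cont2 (T : ℝ) (d : ℕ) (u : ℝ → Path d → ℝ) : Prop :=
  ∀ t₀ ∈ Icc (0 : ℝ) T, ∀ x₀ ∈ Cadlag T d, ∀ ε > (0 : ℝ), ∃ δ > (0 : ℝ),
    ∀ t ∈ Icc (0 : ℝ) T, ∀ x ∈ Cadlag T d,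
      dInf T d (t₀, x₀) (t, x) < δ → |u t x - u t₀ x₀| < ε

/-- `u : [0,T] × Ω → [−∞,∞]` is a non-continuous minimax `L`-supersolution of (TVP). -/
def NCSuper (T : ℝ) (d : ℕ) (H : Ham d) (h : Path d → ℝ) (L : ℝ)
    (u : ℝ → Path d → EReal) : Prop :=
  (∀ x ∈ Cadlag T d, u T x = ((h x : ℝ) : EReal)) ∧
  ∀ t₀ ∈ Ico (0 : ℝ) T, ∀ x₀ ∈ Cadlag T d, ∀ (z : E d) (y₀ : ℝ),
    u t₀ x₀ < ((y₀ : ℝ) : EReal) → ∀ T₀ ∈ Ioc t₀ T,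
      sInf ((fun p : Path d × (ℝ → ℝ) => u T₀ p.1 - ((p.2 T₀ : ℝ) : EReal)) ''
        YSet T d H L t₀ x₀ y₀ z) ≤ 0

/-- `u : [0,T] × Ω → [−∞,∞]` is a non-continuous minimax `L`-subsolution of (TVP). -/
def NCSub (T : ℝ) (d : ℕ) (H : Ham d) (h : Path d → ℝ) (L : ℝ)
    (u : ℝ → Path d → EReal) : Prop :=
  (∀ x ∈ Cadlag T d, u T x = ((h x : ℝ) : EReal)) ∧
  ∀ t₀ ∈ Ico (0 : ℝ) T, ∀ x₀ ∈ Cadlag T d, ∀ (z : E d) (y₀ : ℝ),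
    ((y₀ : ℝ) : EReal) < u t₀ x₀ → ∀ T₀ ∈ Ioc t₀ T,
      0 ≤ sSup ((fun p : Path d × (ℝ → ℝ) => u T₀ p.1 - ((p.2 T₀ : ℝ) : EReal)) ''
        YSet T d H L t₀ x₀ y₀ z)

/-- The function `μ^z_+(t₀, x₀, y₀) = sup{ h(x) − y(T) : (x,y) ∈ Y^{L_H}(t₀,x₀,y₀,z) }`. -/
def muPlus (T : ℝ) (d : ℕ) (H : Ham d) (h : Path d → ℝ) (LH : ℝ) (z : E d)
    (t₀ : ℝ) (x₀ : Path d) (y₀ : ℝ) : EReal :=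
  sSup ((fun p : Path d × (ℝ → ℝ) => ((h p.1 - p.2 T : ℝ) : EReal)) ''
    YSet T d H LH t₀ x₀ y₀ z)

/-- The function `u^z_+` given by `u^z_+(t₀,x₀) = sup{ r ∈ ℝ : μ^z_+(t₀,x₀,r) ≥ 0 }`
(with `sup ∅ = −∞`) for `t₀ < T`, and `u^z_+(T,·) = h`. -/
def uPlus (T : ℝ) (d : ℕ) (H : Ham d) (h : Path d → ℝ) (LH : ℝ) (z : E d)
    (t₀ : ℝ) (x₀ : Path d) : EReal :=
  if t₀ = T then ((h x₀ : ℝ) : EReal)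
  else sSup {v : EReal | ∃ r : ℝ, v = ((r : ℝ) : EReal) ∧ 0 ≤ muPlus T d H h LH z t₀ x₀ r}

/-- The Perron-type function `u₀`, the pointwise infimum of all non-continuous minimax
`L_H`-supersolutions of (TVP). -/
def uZero (T : ℝ) (d : ℕ) (H : Ham d) (h : Path d → ℝ) (LH : ℝ)
    (t : ℝ) (x : Path d) : EReal :=
  sInf {v : EReal | ∃ u : ℝ → Path d → EReal, NCSuper T d H h LH u ∧ v = u t x}

/-- The upper semicontinuous envelope with respect to `d_∞` of an extended-real-valued
function on `[0,T] × Ω`. -/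
def uscEnv (T : ℝ) (d : ℕ) (u : ℝ → Path d → EReal) (t₀ : ℝ) (x₀ : Path d) : EReal :=
  ⨅ δ ∈ Ioi (0 : ℝ),
    sSup {v : EReal | ∃ t ∈ Icc (0 : ℝ) T, ∃ x ∈ Cadlag T d,
      dInf T d (t₀, x₀) (t, x) < δ ∧ v = u t x}

/-- The lower semicontinuous envelope with respect to `d_∞` of an extended-real-valued
function on `[0,T] × Ω`. -/
def lscEnv (T : ℝ) (d : ℕ) (u : ℝ → Path d → EReal) (t₀ : ℝ) (x₀ : Path d) : EReal :=
  ⨆ δ ∈ Ioi (0 : ℝ),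
    sInf {v : EReal | ∃ t ∈ Icc (0 : ℝ) T, ∃ x ∈ Cadlag T d,
      dInf T d (t₀, x₀) (t, x) < δ ∧ v = u t x}


/-- Composing a Carathéodory function of linear growth with a bounded measurable function on a
compact interval gives an integrable function. -/
lemma integrableOn_caratheodory_comp {a b K B : ℝ} {F : ℝ → ℝ → ℝ} {u : ℝ → ℝ} (hK : 0 ≤ K)
    (hmeas : ∀ y, Measurable fun t => F t y) (hcont : ∀ t, Continuous (F t))
    (hF : ∀ t y, |F t y| ≤ K * (1 + |y|))
    (hu : AEMeasurable u (volume.restrict (Icc a b))) (hB : ∀ t ∈ Icc a b, |u t| ≤ B) :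
    IntegrableOn (fun t => F t (u t)) (Icc a b) := by
  have hunc : Measurable (Function.uncurry fun y t => F t y) :=
    measurable_uncurry_of_continuous_of_measurable hcont hmeas
  have hm : AEMeasurable (fun t => F t (u t)) (volume.restrict (Icc a b)) :=
    hunc.comp_aemeasurable (hu.prodMk aemeasurable_id)
  refine IntegrableOn.of_bound measure_Icc_lt_top hm.aestronglyMeasurable (K * (1 + B)) ?_
  filter_upwards [ae_restrict_mem measurableSet_Icc] with t ht
  exact (hF t _).trans (by gcongr; exact hB t ht)

lemma IntegrableOn.intervalIntegrable_left {a b t : ℝ} {f : ℝ → ℝ}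
    (hf : IntegrableOn f (Icc a b)) (ht : t ∈ Icc a b) : IntervalIntegrable f volume a t :=
  (hf.mono_set (by rw [uIcc_of_le ht.1]; exact Icc_subset_Icc_right ht.2)).intervalIntegrable

lemma continuousOn_sub_primitive {a b : ℝ} {f Q : ℝ → ℝ} (hab : a ≤ b)
    (hQ : ContinuousOn Q (Icc a b)) (hf : IntegrableOn f (Icc a b)) :
    ContinuousOn (fun t => Q t - ∫ s in a..t, f s) (Icc a b) := by
  rw [← uIcc_of_le hab] at hQ hf ⊢
  exact hQ.sub (intervalIntegral.continuousOn_primitive_interval hf)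

/-- For an integral equation `u = Q - ∫ F(s, u(s)) ds` with `F` of linear growth, there is a
continuous subsolution lying below any given continuous function. -/
lemma exists_integral_subsolution_le {a b K : ℝ} {F : ℝ → ℝ → ℝ} {Q w : ℝ → ℝ} (hab : a ≤ b)
    (hK : 0 ≤ K) (hmeas : ∀ y, Measurable fun t => F t y) (hcont : ∀ t, Continuous (F t))
    (hF : ∀ t y, |F t y| ≤ K * (1 + |y|))
    (hQ : ContinuousOn Q (Icc a b)) (hw : ContinuousOn w (Icc a b)) :
    ∃ v : ℝ → ℝ, ContinuousOn v (Icc a b) ∧ (∀ t ∈ Icc a b, v t ≤ w t) ∧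
      ∀ t ∈ Icc a b, v t ≤ Q t - ∫ s in a..t, F s (v s) := by
  obtain ⟨M, hM⟩ := isCompact_Icc.exists_bound_of_continuousOn hQ
  obtain ⟨m, hm⟩ := isCompact_Icc.exists_bound_of_continuousOn hw
  have hM0 : 0 ≤ M := (norm_nonneg _).trans (hM a (left_mem_Icc.2 hab))
  have hm0 : 0 ≤ m := (norm_nonneg _).trans (hm a (left_mem_Icc.2 hab))
  set C : ℝ := 2 * M + m + 1 with hC
  set e : ℝ → ℝ := fun t => C * Real.exp (K * (t - a)) with he
  have hC0 : 0 ≤ C := by positivity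
  have he1 : ∀ t ∈ Icc a b, C ≤ e t := fun t ht => by
    have h1 : 1 ≤ Real.exp (K * (t - a)) :=
      Real.one_le_exp (mul_nonneg hK (sub_nonneg.2 ht.1))
    exact le_mul_of_one_le_right hC0 h1
  have hecont : Continuous e := by fun_prop
  have hvcont : ContinuousOn (fun t => Q t - (e t - (1 + M))) (Icc a b) :=
    hQ.sub (hecont.sub continuous_const).continuousOn
  refine ⟨fun t => Q t - (e t - (1 + M)), hvcont, fun t ht => ?_, fun t ht => ?_⟩
  · have h1 := abs_le.1 (hM t ht)
    have h2 := abs_le.1 (hm t ht)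
    have h3 := he1 t ht
    linarith
  · obtain ⟨B, hB⟩ := isCompact_Icc.exists_bound_of_continuousOn hvcont
    have hintble := integrableOn_caratheodory_comp hK hmeas hcont hF
      (hvcont.aemeasurable measurableSet_Icc) hB
    have hder : ∀ r, HasDerivAt e (K * e r) r := fun r => by
      have h1 : HasDerivAt (fun t => K * (t - a)) (K * 1) r :=
        ((hasDerivAt_id r).sub_const a).const_mul K
      exact (h1.exp.const_mul C).congr_deriv (by simp only [he]; ring)
    have hle : ∫ s in a..t, F s (Q s - (e s - (1 + M))) ≤ ∫ s in a..t, K * e s := by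
      refine intervalIntegral.integral_mono_on ht.1 (IntegrableOn.intervalIntegrable_left hintble ht)
        ((continuous_const.mul hecont).intervalIntegrable _ _) fun s hs => ?_
      have hs' : s ∈ Icc a b := ⟨hs.1, hs.2.trans ht.2⟩
      refine (le_abs_self _).trans ((hF s _).trans (mul_le_mul_of_nonneg_left ?_ hK))
      have h1 := abs_le.1 (hM s hs')
      have h3 := he1 s hs'
      have : |Q s - (e s - (1 + M))| ≤ e s - 1 := abs_le.2 ⟨by linarith, by linarith⟩
      linarith
    rw [intervalIntegral.integral_eq_sub_of_hasDerivAt (fun r _ => hder r)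
      ((continuous_const.mul hecont).intervalIntegrable _ _)] at hle
    have hea : e a = C := by simp [he]
    change Q t - (e t - (1 + M)) ≤ Q t - ∫ s in a..t, F s (Q s - (e s - (1 + M)))
    linarith

/-- Below every supersolution `w` of the integral equation `u = Q - ∫ F(s, u(s)) ds`, with `F`
a Carathéodory function of linear growth that is antitone in the second variable, there is a
solution. -/
lemma exists_integral_solution_le {a b K : ℝ} {F : ℝ → ℝ → ℝ} {Q w : ℝ → ℝ} (hab : a ≤ b)
    (hK : 0 ≤ K) (hmeas : ∀ y, Measurable fun t => F t y) (hcont : ∀ t, Continuous (F t))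
    (hanti : ∀ t, Antitone (F t)) (hF : ∀ t y, |F t y| ≤ K * (1 + |y|))
    (hQ : ContinuousOn Q (Icc a b)) (hw : ContinuousOn w (Icc a b))
    (hsuper : ∀ t ∈ Icc a b, Q t - ∫ s in a..t, F s (w s) ≤ w t) :
    ∃ u : ℝ → ℝ, ContinuousOn u (Icc a b) ∧ IntegrableOn (fun t => F t (u t)) (Icc a b) ∧
      (∀ t ∈ Icc a b, u t = Q t - ∫ s in a..t, F s (u s)) ∧ ∀ t ∈ Icc a b, u t ≤ w t := by
  obtain ⟨v, hv, hvw, hsub⟩ := exists_integral_subsolution_le hab hK hmeas hcont hF hQ hw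
  obtain ⟨Bv, hBv⟩ := isCompact_Icc.exists_bound_of_continuousOn hv
  obtain ⟨Bw, hBw⟩ := isCompact_Icc.exists_bound_of_continuousOn hw
  have hbound : ∀ {r t : ℝ}, t ∈ Icc a b → v t ≤ r → r ≤ w t → |r| ≤ max Bv Bw := by
    intro r t ht h1 h2
    have h3 := abs_le.1 (hBv t ht)
    have h4 := abs_le.1 (hBw t ht)
    have h5 := le_max_left Bv Bw
    have h6 := le_max_right Bv Bw
    exact abs_le.2 ⟨by linarith, by linarith⟩
  have hintble : ∀ {u : ℝ → ℝ}, AEMeasurable u (volume.restrict (Icc a b)) →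
      (∀ t ∈ Icc a b, v t ≤ u t ∧ u t ≤ w t) →
      IntegrableOn (fun t => F t (u t)) (Icc a b) := fun hu hb =>
    integrableOn_caratheodory_comp hK hmeas hcont hF hu
      fun t ht => hbound ht (hb t ht).1 (hb t ht).2
  set Φ : (ℝ → ℝ) → ℝ → ℝ := fun u t => Q t - ∫ s in a..t, F s (u s) with hΦ
  have hmono : ∀ {u u' : ℝ → ℝ}, IntegrableOn (fun t => F t (u t)) (Icc a b) →
      IntegrableOn (fun t => F t (u' t)) (Icc a b) → (∀ t ∈ Icc a b, u t ≤ u' t) →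
      ∀ t ∈ Icc a b, Φ u t ≤ Φ u' t := by
    intro u u' hu hu' hle t ht
    refine sub_le_sub_left (intervalIntegral.integral_mono_on ht.1
      (IntegrableOn.intervalIntegrable_left hu' ht) (IntegrableOn.intervalIntegrable_left hu ht)
      fun s hs => hanti s (hle s ⟨hs.1, hs.2.trans ht.2⟩)) _
  have hvint := hintble (hv.aemeasurable measurableSet_Icc) fun t ht => ⟨le_rfl, hvw t ht⟩
  have hwint := hintble (hw.aemeasurable measurableSet_Icc) fun t ht => ⟨hvw t ht, le_rfl⟩
  set Y : ℕ → ℝ → ℝ := fun n => Φ^[n] w with hY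
  have hYsucc : ∀ n, Y (n + 1) = Φ (Y n) := fun n => Function.iterate_succ_apply' Φ n w
  have hinv : ∀ n, ContinuousOn (Y n) (Icc a b) ∧ ∀ t ∈ Icc a b, v t ≤ Y n t ∧ Y n t ≤ w t := by
    intro n
    induction n with
    | zero => exact ⟨hw, fun t ht => ⟨hvw t ht, le_rfl⟩⟩
    | succ n ih =>
      have hi := hintble (ih.1.aemeasurable measurableSet_Icc) ih.2
      rw [hYsucc]
      exact ⟨continuousOn_sub_primitive hab hQ hi, fun t ht =>
        ⟨(hsub t ht).trans (hmono hvint hi (fun s hs => (ih.2 s hs).1) t ht),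
          (hmono hi hwint (fun s hs => (ih.2 s hs).2) t ht).trans (hsuper t ht)⟩⟩
  have hYint : ∀ n, IntegrableOn (fun t => F t (Y n t)) (Icc a b) := fun n =>
    hintble ((hinv n).1.aemeasurable measurableSet_Icc) (hinv n).2
  have hdec : ∀ n, ∀ t ∈ Icc a b, Y (n + 1) t ≤ Y n t := by
    intro n
    induction n with
    | zero => exact hsuper
    | succ n ih =>
      intro t ht
      have h1 := hmono (hYint (n + 1)) (hYint n) ih t ht
      rwa [← hYsucc, ← hYsucc] at h1
  set u : ℝ → ℝ := fun t => ⨅ n, Y n t with hu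
  have hlim : ∀ t ∈ Icc a b, Tendsto (fun n => Y n t) atTop (𝓝 (u t)) := fun t ht =>
    tendsto_atTop_ciInf (antitone_nat_of_succ_le fun n => hdec n t ht)
      ⟨v t, by rintro _ ⟨n, rfl⟩; exact ((hinv n).2 t ht).1⟩
  have hub : ∀ t ∈ Icc a b, v t ≤ u t ∧ u t ≤ w t := fun t ht =>
    ⟨ge_of_tendsto' (hlim t ht) fun n => ((hinv n).2 t ht).1,
      le_of_tendsto' (hlim t ht) fun n => ((hinv n).2 t ht).2⟩
  have hum : AEMeasurable u (volume.restrict (Icc a b)) :=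
    aemeasurable_of_tendsto_metrizable_ae' (fun n => (hinv n).1.aemeasurable measurableSet_Icc)
      ((ae_restrict_mem measurableSet_Icc).mono hlim)
  have huint := hintble hum hub
  have heq : ∀ t ∈ Icc a b, u t = Q t - ∫ s in a..t, F s (u s) := by
    intro t ht
    have hsubset : ∀ {s}, s ∈ uIoc a t → s ∈ Icc a b := fun {s} hs => by
      rw [uIoc_of_le ht.1] at hs
      exact ⟨hs.1.le, hs.2.trans ht.2⟩
    have hconv : Tendsto (fun n => ∫ s in a..t, F s (Y n s)) atTop
        (𝓝 (∫ s in a..t, F s (u s))) := by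
      refine intervalIntegral.tendsto_integral_filter_of_dominated_convergence
        (fun _ => K * (1 + max Bv Bw)) (Eventually.of_forall fun n => ?_)
        (Eventually.of_forall fun n => Eventually.of_forall fun s hs => ?_)
        intervalIntegrable_const
        (Eventually.of_forall fun s hs => ?_)
      · exact ((hYint n).mono_set fun s hs => hsubset hs).aestronglyMeasurable
      · have hs' := hsubset hs
        refine (hF s _).trans ?_
        gcongr
        exact hbound hs' ((hinv n).2 s hs').1 ((hinv n).2 s hs').2
      · exact ((hcont s).tendsto _).comp (hlim s (hsubset hs))
    refine tendsto_nhds_unique ((tendsto_add_atTop_iff_nat 1).2 (hlim t ht)) ?_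
    simp only [hYsucc]
    exact hconv.const_sub (Q t)
  exact ⟨u, (continuousOn_sub_primitive hab hQ huint).congr heq, huint, heq,
    fun t ht => (hub t ht).2⟩

lemma bddAbove_norm_of_mem_cadlag {T : ℝ} {d : ℕ} {x : Path d} (hx : x ∈ Cadlag T d) :
    BddAbove ((fun s => ‖x s‖) '' Icc 0 T) := by
  have hloc : ∀ {l : Filter ℝ} {y : E d}, Tendsto x l (𝓝 y) →
      ∃ s ∈ l, BddAbove ((fun r => ‖x r‖) '' s) := fun {l y} hl =>
    ⟨_, hl.norm.eventually_le_const (lt_add_one ‖y‖), ‖y‖ + 1, by rintro _ ⟨r, hr, rfl⟩; exact hr⟩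
  refine isCompact_Icc.induction_on (p := fun s => BddAbove ((fun r => ‖x r‖) '' s)) (by simp)
    (fun s t hst ht => ht.mono (image_mono hst))
    (fun s t hs ht => by rw [image_union]; exact hs.union ht) fun t ht => ?_
  have hleft : ∃ s ∈ 𝓝[Icc 0 T ∩ Iio t] t, BddAbove ((fun r => ‖x r‖) '' s) := by
    rcases ht.1.eq_or_lt with rfl | h0
    · refine ⟨∅, ?_, by simp⟩
      have : Icc 0 T ∩ Iio 0 = (∅ : Set ℝ) := by
        ext r; simp only [mem_inter_iff, mem_Icc, mem_Iio, mem_empty_iff_false, iff_false]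
        rintro ⟨h1, h2⟩; linarith
      simp [this]
    · obtain ⟨l, hl⟩ := hx.2 t ⟨h0, ht.2⟩
      exact hloc (hl.mono_left (nhdsWithin_mono t inter_subset_right))
  have hright : ∃ s ∈ 𝓝[Icc 0 T ∩ Ici t] t, BddAbove ((fun r => ‖x r‖) '' s) := by
    rcases ht.2.eq_or_lt with rfl | hT
    · refine ⟨{t}, ?_, by simp⟩
      refine mem_of_superset self_mem_nhdsWithin fun r hr => ?_
      exact le_antisymm hr.1.2 hr.2
    · exact hloc ((hx.1 t ⟨ht.1, hT⟩).mono_left (nhdsWithin_mono t inter_subset_right))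
  obtain ⟨s₁, hs₁, hb₁⟩ := hleft
  obtain ⟨s₂, hs₂, hb₂⟩ := hright
  refine ⟨s₁ ∪ s₂, ?_, by rw [image_union]; exact hb₁.union hb₂⟩
  have : Icc 0 T = (Icc 0 T ∩ Iio t) ∪ (Icc 0 T ∩ Ici t) := by
    rw [← inter_union_distrib_left, Iio_union_Ici, inter_univ]
  rw [this, nhdsWithin_union]
  exact union_mem_sup hs₁ hs₂

lemma runSup_nonneg {d : ℕ} (x : Path d) (t : ℝ) : 0 ≤ runSup d x t :=
  Real.sSup_nonneg (by rintro _ ⟨r, -, rfl⟩; exact norm_nonneg _)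

lemma runSup_le_runSup {T : ℝ} {d : ℕ} {x : Path d} (hx : x ∈ Cadlag T d) {t : ℝ}
    (ht : t ∈ Icc 0 T) : runSup d x t ≤ runSup d x T :=
  csSup_le_csSup (bddAbove_norm_of_mem_cadlag hx) ⟨_, mem_image_of_mem _ (left_mem_Icc.2 ht.1)⟩
    (image_mono (Icc_subset_Icc_right ht.2))

lemma supDist_self (T : ℝ) (d : ℕ) (x : Path d) : supDist T d x x ≤ 0 := by
  refine Real.sSup_nonpos ?_
  rintro _ ⟨r, -, rfl⟩
  simp

/-- Along a fixed path, `y ↦ H(t, x, y, z)` agrees for a.e. `t` with a Carathéodory function that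
is antitone and of linear growth in `y`, uniformly in `t`. -/
lemma exists_caratheodory_version {T : ℝ} {d : ℕ} {H : Ham d} {LH CH : ℝ}
    (hH1 : HamCont T d H) (hH2 : HamMeas d H) (hH3 : HamLipZ T d H LH)
    (hH5 : HamMono T d H) (hH6 : HamBound T d H CH) {x : Path d} (hx : x ∈ Cadlag T d) (z : E d) :
    ∃ (F : ℝ → ℝ → ℝ) (K : ℝ), 0 ≤ K ∧ (∀ y, Measurable fun t => F t y) ∧
      (∀ t, Continuous (F t)) ∧ (∀ t, Antitone (F t)) ∧ (∀ t y, |F t y| ≤ K * (1 + |y|)) ∧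
      ∀ᵐ t ∂(volume.restrict (Icc (0 : ℝ) T)), ∀ y, F t y = H t x y z := by
  obtain ⟨hLH, hH3⟩ := hH3
  obtain ⟨hCH, hH6⟩ := hH6
  set R := runSup d x T with hR
  have hR0 : 0 ≤ R := runSup_nonneg x T
  set K := CH * (1 + R) + LH * (1 + R) * ‖z‖ with hKdef
  have hK : 0 ≤ K := by positivity
  have hgood : ∀ᵐ t ∂(volume.restrict (Icc (0 : ℝ) T)), Continuous (fun y => H t x y z) ∧
      Antitone (fun y => H t x y z) ∧ ∀ y, |H t x y z| ≤ K * (1 + |y|) := by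
    rw [← Measure.restrict_congr_set (Ioo_ae_eq_Icc (μ := volume) (a := (0 : ℝ)) (b := T))]
    filter_upwards [hH1, hH3, hH5, hH6, ae_restrict_mem measurableSet_Ioo] with t h1 h3 h5 h6 ht
    refine ⟨Metric.continuous_iff.2 fun y ε hε => ?_, fun y y' hyy => h5 x hx z y y' hyy,
      fun y => ?_⟩
    · obtain ⟨δ, hδ, h⟩ := h1 x hx y z ε hε
      refine ⟨δ, hδ, fun y' hy' => ?_⟩
      rw [dist_comm, Real.dist_eq] at hy' ⊢
      exact h x hx y' z ((supDist_self T d x).trans_lt hδ) hy' (by simpa using hδ)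
    · have hr : runSup d x t ≤ R := runSup_le_runSup hx ⟨ht.1.le, ht.2.le⟩
      have e1 : |H t x y z - H t x y 0| ≤ LH * (1 + R) * ‖z‖ := by
        have := h3 x hx y z 0
        rw [sub_zero] at this
        exact this.trans (by gcongr)
      have e2 : |H t x y 0| ≤ CH * (1 + R + |y|) := (h6 x hx y).trans (by gcongr)
      have e3 : |H t x y z| ≤ |H t x y z - H t x y 0| + |H t x y 0| := by
        simpa using abs_add_le (H t x y z - H t x y 0) (H t x y 0)
      have e4 : CH * (1 + R + |y|) ≤ CH * (1 + R) * (1 + |y|) := by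
        have : 0 ≤ CH * (R * |y|) := by positivity
        nlinarith
      have e5 : LH * (1 + R) * ‖z‖ ≤ LH * (1 + R) * ‖z‖ * (1 + |y|) :=
        le_mul_of_one_le_right (by positivity) (by linarith [abs_nonneg y])
      rw [hKdef, add_mul]
      linarith
  obtain ⟨A, hAae, hAm, hA⟩ := hgood.exists_measurable_mem
  refine ⟨fun t y => A.indicator (fun r => H r x y z) t, K, hK,
    fun y => (hH2 x y z).indicator hAm, fun t => ?_, fun t => ?_, fun t y => ?_, ?_⟩
  · by_cases h : t ∈ A
    · simpa [h] using (hA t h).1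
    · simpa [h] using continuous_const
  · by_cases h : t ∈ A
    · simpa [h] using (hA t h).2.1
    · simpa [h] using antitone_const
  · by_cases h : t ∈ A
    · simpa [h] using (hA t h).2.2 y
    · simp only [h, not_false_eq_true, indicator_of_notMem, abs_zero]
      positivity
  · filter_upwards [hAae] with t ht y
    exact indicator_of_mem ht _

/-- Characteristics started lower by `s ≥ 0` can be chosen to stay lower by at least `s`. -/
lemma exists_mem_YSet_le_sub {T : ℝ} {d : ℕ} {H : Ham d} {LH CH L : ℝ}
    (hH1 : HamCont T d H) (hH2 : HamMeas d H) (hH3 : HamLipZ T d H LH)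
    (hH5 : HamMono T d H) (hH6 : HamBound T d H CH) {z : E d} {t₀ : ℝ} (ht₀ : t₀ ∈ Ico (0 : ℝ) T)
    {x₀ : Path d} {y₀ s : ℝ} (hs : 0 ≤ s) {p : Path d × (ℝ → ℝ)}
    (hp : p ∈ YSet T d H L t₀ x₀ (y₀ + s) z) :
    ∃ u : ℝ → ℝ, (p.1, u) ∈ YSet T d H L t₀ x₀ y₀ z ∧ ∀ t ∈ Icc t₀ T, u t ≤ p.2 t - s := by
  obtain ⟨x, y⟩ := p
  obtain ⟨hx, hx₀, hy, g, hg, hintble, heq⟩ := hp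
  simp only at hx hx₀ hy hg hintble heq ⊢
  obtain ⟨F, K, hK, hmeas, hcont, hanti, hF, hFH⟩ :=
    exists_caratheodory_version hH1 hH2 hH3 hH5 hH6 hx z
  have hab : t₀ ≤ T := ht₀.2.le
  have hFH' : ∀ᵐ t ∂(volume.restrict (Icc t₀ T)), ∀ y, F t y = H t x y z :=
    ae_restrict_of_ae_restrict_of_subset (Icc_subset_Icc_left ht₀.1) hFH
  have hq : IntegrableOn (fun r => ⟪g r, z⟫_ℝ) (Icc t₀ T) := hg.1.inner_const z
  have hQ : ContinuousOn (fun t => y₀ + ∫ r in t₀..t, ⟪g r, z⟫_ℝ) (Icc t₀ T) := by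
    rw [← uIcc_of_le hab] at hq ⊢
    exact continuousOn_const.add (intervalIntegral.continuousOn_primitive_interval hq)
  have hcongr : ∀ (v : ℝ → ℝ), (fun r => ⟪g r, z⟫_ℝ - F r (v r))
      =ᵐ[volume.restrict (Icc t₀ T)] fun r => ⟪g r, z⟫_ℝ - H r x (v r) z := fun v => by
    filter_upwards [hFH'] with r hr
    rw [hr]
  have hintegral : ∀ (v : ℝ → ℝ), IntegrableOn (fun r => F r (v r)) (Icc t₀ T) →
      ∀ t ∈ Icc t₀ T, ∫ r in t₀..t, (⟪g r, z⟫_ℝ - H r x (v r) z) =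
        (∫ r in t₀..t, ⟪g r, z⟫_ℝ) - ∫ r in t₀..t, F r (v r) := by
    intro v hv t ht
    rw [← intervalIntegral.integral_sub (IntegrableOn.intervalIntegrable_left hq ht)
      (IntegrableOn.intervalIntegrable_left hv ht)]
    refine intervalIntegral.integral_congr_ae ?_
    filter_upwards [(ae_restrict_iff' measurableSet_Icc).1 (hcongr v)] with r hr hrt
    rw [uIoc_of_le ht.1] at hrt
    exact (hr ⟨hrt.1.le, hrt.2.trans ht.2⟩).symm
  have hFint : ∀ {v : ℝ → ℝ}, ContinuousOn v (Icc t₀ T) →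
      IntegrableOn (fun r => F r (v r)) (Icc t₀ T) := fun {v} hv => by
    obtain ⟨B, hB⟩ := isCompact_Icc.exists_bound_of_continuousOn hv
    exact integrableOn_caratheodory_comp hK hmeas hcont hF (hv.aemeasurable measurableSet_Icc) hB
  have hw : ContinuousOn (fun t => y t - s) (Icc t₀ T) := hy.sub continuousOn_const
  obtain ⟨u, hu, huint, hueq, hule⟩ := exists_integral_solution_le hab hK hmeas hcont hanti hF
    hQ hw fun t ht => by
      have h1 := heq t ht
      rw [hintegral y (hFint hy) t ht] at h1
      have h2 : ∫ r in t₀..t, F r (y r) ≤ ∫ r in t₀..t, F r (y r - s) :=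
        intervalIntegral.integral_mono_on ht.1
          (IntegrableOn.intervalIntegrable_left (hFint hy) ht)
          (IntegrableOn.intervalIntegrable_left (hFint hw) ht)
          fun r _ => hanti r (sub_le_self _ hs)
      linarith
  refine ⟨u, ⟨hx, hx₀, hu, g, hg, (hq.sub huint).congr (hcongr u), fun t ht => ?_⟩, hule⟩
  change u t = y₀ + ∫ r in t₀..t, (⟪g r, z⟫_ℝ - H r x (u r) z)
  rw [hintegral u huint t ht, hueq t ht]
  ring

/-- For every `z`, `(t₀,x₀) ∈ [0,T) × Ω`, `y₀ ∈ ℝ` and `s ≥ 0`, one has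
`μ^z_+(t₀,x₀,y₀+s) ≤ μ^z_+(t₀,x₀,y₀) − s` in `[−∞,∞)`. -/
theorem muPlus_shift (T : ℝ) (hT : 0 < T) (d : ℕ) (hd : 1 ≤ d)
    (H : Ham d) (LH CH : ℝ)
    (hH1 : HamCont T d H) (hH2 : HamMeas d H) (hH3 : HamLipZ T d H LH)
    (hH5 : HamMono T d H) (hH6 : HamBound T d H CH)
    (h : Path d → ℝ) (hh : TermCont T d h)
    (z : E d) (t₀ : ℝ) (ht₀ : t₀ ∈ Ico (0 : ℝ) T)
    (x₀ : Path d) (hx₀ : x₀ ∈ Cadlag T d) (y₀ s : ℝ) (hs : 0 ≤ s) :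
    muPlus T d H h LH z t₀ x₀ (y₀ + s) ≤ muPlus T d H h LH z t₀ x₀ y₀ - ((s : ℝ) : EReal) := by
  refine sSup_le ?_
  rintro _ ⟨p, hp, rfl⟩
  obtain ⟨u, hu, hle⟩ := exists_mem_YSet_le_sub hH1 hH2 hH3 hH5 hH6 ht₀ hs hp
  have hmem : ((h p.1 - u T : ℝ) : EReal) ≤ muPlus T d H h LH z t₀ x₀ y₀ :=
    le_sSup ⟨(p.1, u), hu, rfl⟩
  refine le_trans ?_ (EReal.sub_le_sub hmem le_rfl)
  rw [← EReal.coe_sub]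
  refine EReal.coe_le_coe_iff.2 ?_
  have := hle T (right_mem_Icc.2 ht₀.2.le)
  linarith

end PHJ
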